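/- Let γ ≥ 0, p ≥ 2 and let q = p/(p−1) be the Hölder conjugate of p. There exists a constant C > 0 such that for every smooth compactly supported f: ℝⁿ × ℝᵐ → ℝ, ∫ |x|^{γq} N^{p−γq} |f|^q dμ ≤ C ( ∫ |∇_γ f|^q dμ + ∫ |f|^q dμ ). -/

import Mathlib

open MeasureTheory

/-- The Grushin Kaplan norm `N(x,y) = (|x|^{2(1+γ)} + (1+γ)²|y|²)^{1/(2+2γ)}` on `ℝⁿ × ℝᵐ`. -/
noncomputable def GKaplan (n m : ℕ) (γ : ℝ)
    (w : EuclideanSpace ℝ (Fin n) × EuclideanSpace ℝ (Fin m)) : ℝ :=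
  (‖w.1‖ ^ (2 * (1 + γ)) + (1 + γ) ^ 2 * ‖w.2‖ ^ 2) ^ (1 / (2 + 2 * γ))

/-- Partial derivative `∂_{x_i} f` in the `i`-th coordinate of the `x`-variable. -/
noncomputable def dX (n m : ℕ)
    (f : EuclideanSpace ℝ (Fin n) × EuclideanSpace ℝ (Fin m) → ℝ)
    (w : EuclideanSpace ℝ (Fin n) × EuclideanSpace ℝ (Fin m)) (i : Fin n) : ℝ :=
  fderiv ℝ f w (EuclideanSpace.single i (1 : ℝ), 0)

/-- Partial derivative `∂_{y_j} f` in the `j`-th coordinate of the `y`-variable. -/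
noncomputable def dY (n m : ℕ)
    (f : EuclideanSpace ℝ (Fin n) × EuclideanSpace ℝ (Fin m) → ℝ)
    (w : EuclideanSpace ℝ (Fin n) × EuclideanSpace ℝ (Fin m)) (j : Fin m) : ℝ :=
  fderiv ℝ f w (0, EuclideanSpace.single j (1 : ℝ))

/-- The squared length of the Grushin subgradient:
`|∇_γ f|² = |∇_x f|² + |x|^{2γ} |∇_y f|²`. -/
noncomputable def gradSqG (n m : ℕ) (γ : ℝ)
    (f : EuclideanSpace ℝ (Fin n) × EuclideanSpace ℝ (Fin m) → ℝ)
    (w : EuclideanSpace ℝ (Fin n) × EuclideanSpace ℝ (Fin m)) : ℝ :=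
  (∑ i, (dX n m f w i) ^ 2) + ‖w.1‖ ^ (2 * γ) * ∑ j, (dY n m f w j) ^ 2

/-- The probability measure `dμ = Z⁻¹ e^{-N^p} dξ` on `ℝⁿ × ℝᵐ` in the Grushin setting. -/
noncomputable def muG (n m : ℕ) (γ p : ℝ) :
    Measure (EuclideanSpace ℝ (Fin n) × EuclideanSpace ℝ (Fin m)) :=
  volume.withDensity (fun w => ENNReal.ofReal
    ((∫ v : EuclideanSpace ℝ (Fin n) × EuclideanSpace ℝ (Fin m),
        Real.exp (-(GKaplan n m γ v) ^ p))⁻¹ * Real.exp (-(GKaplan n m γ w) ^ p)))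

section

open Real

/-- The anisotropic dilation `(x, y) ↦ (eᵗ x, e^{σt} y)`. -/
noncomputable def grushinDilation {n m : ℕ} (σ t : ℝ)
    (w : EuclideanSpace ℝ (Fin n) × EuclideanSpace ℝ (Fin m)) :
    EuclideanSpace ℝ (Fin n) × EuclideanSpace ℝ (Fin m) :=
  (exp t • w.1, exp (σ * t) • w.2)

/-- The generator `(x, y) ↦ (x, σ y)` of the anisotropic dilations. -/
noncomputable def grushinEuler {n m : ℕ} (σ : ℝ)
    (w : EuclideanSpace ℝ (Fin n) × EuclideanSpace ℝ (Fin m)) :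
    EuclideanSpace ℝ (Fin n) × EuclideanSpace ℝ (Fin m) :=
  (w.1, σ • w.2)

lemma continuous_grushinDilation {n m : ℕ} (σ t : ℝ) :
    Continuous (grushinDilation (n := n) (m := m) σ t) := by
  unfold grushinDilation; fun_prop

lemma continuous_grushinEuler {n m : ℕ} (σ : ℝ) :
    Continuous (grushinEuler (n := n) (m := m) σ) := by
  unfold grushinEuler; fun_prop

@[simp] lemma grushinDilation_zero {n m : ℕ} (σ : ℝ)
    (w : EuclideanSpace ℝ (Fin n) × EuclideanSpace ℝ (Fin m)) :
    grushinDilation σ 0 w = w := by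
  simp [grushinDilation]

lemma hasDerivAt_grushinDilation {n m : ℕ} (σ t : ℝ)
    (w : EuclideanSpace ℝ (Fin n) × EuclideanSpace ℝ (Fin m)) :
    HasDerivAt (fun s => grushinDilation σ s w) (grushinEuler σ (grushinDilation σ t w)) t := by
  have h1 : HasDerivAt (fun s : ℝ => exp s • w.1) (exp t • w.1) t :=
    (hasDerivAt_exp t).smul_const _
  have h2 : HasDerivAt (fun s : ℝ => exp (σ * s) • w.2) (σ • exp (σ * t) • w.2) t := by
    refine ((((hasDerivAt_id t).const_mul σ).exp).smul_const w.2).congr_deriv ?_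
    simp [smul_smul, mul_comm]
  exact h1.prodMk h2

lemma map_grushinDilation {n m : ℕ} (σ t : ℝ) :
    Measure.map (grushinDilation (n := n) (m := m) σ t) volume =
      ENNReal.ofReal (exp (-((n + σ * m) * t))) • volume := by
  have h : grushinDilation (n := n) (m := m) σ t =
      Prod.map (fun x => exp t • x) (fun y => exp (σ * t) • y) := rfl
  rw [h, Measure.volume_eq_prod,
    ← Measure.map_prod_map _ _ (measurable_const_smul _) (measurable_const_smul _),
    Measure.map_addHaar_smul _ (exp_pos _).ne', Measure.map_addHaar_smul _ (exp_pos _).ne',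
    Measure.prod_smul_left, Measure.prod_smul_right, smul_smul,
    ← ENNReal.ofReal_mul (abs_nonneg _)]
  congr 2
  simp only [finrank_euclideanSpace, Fintype.card_fin]
  rw [abs_of_pos (by positivity), abs_of_pos (by positivity), ← exp_nat_mul, ← exp_nat_mul,
    ← exp_neg, ← exp_neg, ← exp_add]
  congr 1; ring

lemma integral_comp_grushinDilation {n m : ℕ} (σ t : ℝ)
    {H : EuclideanSpace ℝ (Fin n) × EuclideanSpace ℝ (Fin m) → ℝ} (hH : Measurable H) :
    ∫ w, H (grushinDilation σ t w) = exp (-((n + σ * m) * t)) * ∫ w, H w := by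
  rw [← integral_map (continuous_grushinDilation σ t).aemeasurable hH.aestronglyMeasurable,
    map_grushinDilation, integral_smul_measure, ENNReal.toReal_ofReal (exp_pos _).le, smul_eq_mul]

section Kaplan

variable {n m : ℕ} {γ : ℝ}

lemma GKaplan_nonneg (w : EuclideanSpace ℝ (Fin n) × EuclideanSpace ℝ (Fin m)) :
    0 ≤ GKaplan n m γ w := by
  unfold GKaplan; positivity

lemma continuous_GKaplan (hγ : 0 ≤ γ) : Continuous (GKaplan n m γ) := by
  unfold GKaplan
  refine Continuous.rpow_const ?_ fun _ => Or.inr (by positivity)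
  exact ((continuous_fst.norm).rpow_const fun _ => Or.inr (by positivity)).add (by fun_prop)

lemma GKaplan_rpow (hγ : 0 ≤ γ) (w : EuclideanSpace ℝ (Fin n) × EuclideanSpace ℝ (Fin m)) :
    GKaplan n m γ w ^ (2 * (1 + γ)) = ‖w.1‖ ^ (2 * (1 + γ)) + (1 + γ) ^ 2 * ‖w.2‖ ^ 2 := by
  unfold GKaplan
  rw [← rpow_mul (by positivity), show 1 / (2 + 2 * γ) * (2 * (1 + γ)) = 1 by field_simp,
    rpow_one]

lemma norm_fst_le_GKaplan (hγ : 0 ≤ γ)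
    (w : EuclideanSpace ℝ (Fin n) × EuclideanSpace ℝ (Fin m)) :
    ‖w.1‖ ≤ GKaplan n m γ w := by
  rw [← rpow_le_rpow_iff (norm_nonneg _) (GKaplan_nonneg w) (z := 2 * (1 + γ)) (by positivity),
    GKaplan_rpow hγ]
  linarith [show 0 ≤ (1 + γ) ^ 2 * ‖w.2‖ ^ 2 by positivity]

lemma GKaplan_dilation (hγ : 0 ≤ γ) (t : ℝ)
    (w : EuclideanSpace ℝ (Fin n) × EuclideanSpace ℝ (Fin m)) :
    GKaplan n m γ (grushinDilation (1 + γ) t w) = exp t * GKaplan n m γ w := by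
  rw [← rpow_left_inj (GKaplan_nonneg _) (mul_nonneg (exp_pos t).le (GKaplan_nonneg _))
    (z := 2 * (1 + γ)) (by positivity), mul_rpow (exp_pos t).le (GKaplan_nonneg _),
    GKaplan_rpow hγ, GKaplan_rpow hγ]
  simp only [grushinDilation, norm_smul, norm_of_nonneg (exp_pos _).le]
  rw [mul_rpow (exp_pos t).le (norm_nonneg _), mul_pow, ← exp_mul, ← exp_nat_mul,
    show ((2 : ℕ) : ℝ) * ((1 + γ) * t) = t * (2 * (1 + γ)) by push_cast; ring]
  ring

lemma eq_zero_of_GKaplan_eq_zero (hγ : 0 ≤ γ)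
    {w : EuclideanSpace ℝ (Fin n) × EuclideanSpace ℝ (Fin m)} (h : GKaplan n m γ w = 0) :
    w = 0 := by
  have h1 := GKaplan_rpow hγ w
  rw [h, zero_rpow (by positivity)] at h1
  have hx : ‖w.1‖ = 0 := le_antisymm (h ▸ norm_fst_le_GKaplan hγ w) (norm_nonneg _)
  rw [hx, zero_rpow (by positivity), zero_add] at h1
  have hy : ‖w.2‖ = 0 := by
    have : (1 + γ) ^ 2 ≠ 0 := by positivity
    simpa [this] using h1.symm
  exact Prod.ext (norm_eq_zero.1 hx) (norm_eq_zero.1 hy)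

/-- Integration by parts along the dilations, against a bounded dilation-invariant weight. -/
lemma integral_fderiv_grushinEuler {p : ℝ} (hγ : 0 ≤ γ) (hp : 0 < p)
    {φ g : EuclideanSpace ℝ (Fin n) × EuclideanSpace ℝ (Fin m) → ℝ}
    (hφm : Measurable φ) (hφ1 : ∀ w, |φ w| ≤ 1)
    (hφ : ∀ t w, φ (grushinDilation (1 + γ) t w) = φ w)
    (hg : ContDiff ℝ 1 g) (hgc : HasCompactSupport g)
    (hZi : Integrable (fun w => exp (-(GKaplan n m γ w) ^ p))) :
    ∫ w, φ w * exp (-(GKaplan n m γ w) ^ p) * fderiv ℝ g w (grushinEuler (1 + γ) w) =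
      (∫ w, φ w * exp (-(GKaplan n m γ w) ^ p) * (p * (GKaplan n m γ w) ^ p * g w)) -
        (n + (1 + γ) * m) * ∫ w, φ w * exp (-(GKaplan n m γ w) ^ p) * g w := by
  set N := GKaplan n m γ with hN
  set Q : ℝ := n + (1 + γ) * m with hQ
  have hNc : Continuous N := continuous_GKaplan hγ
  have hN0 : ∀ w, 0 ≤ N w := GKaplan_nonneg
  have hNp : Continuous fun w => N w ^ p := hNc.rpow_const fun _ => Or.inr hp.le
  have hNpm := hNp.measurable
  have hgm := hg.continuous.measurable
  have hDc : Continuous fun w => fderiv ℝ g w (grushinEuler (1 + γ) w) :=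
    (hg.continuous_fderiv one_ne_zero).clm_apply (continuous_grushinEuler _)
  have hDs : HasCompactSupport fun w => fderiv ℝ g w (grushinEuler (1 + γ) w) := by
    refine (hgc.fderiv (𝕜 := ℝ)).mono fun w hw => ?_
    rw [Function.mem_support] at hw ⊢
    contrapose! hw
    simp [hw]
  obtain ⟨B, hB⟩ := hDs.exists_bound_of_continuous hDc
  have hδ : ∀ t, Measurable (grushinDilation (n := n) (m := m) (1 + γ) t) :=
    fun t => (continuous_grushinDilation _ t).measurable
  have hφN : Integrable fun w => φ w * exp (-N w ^ p) :=
    hZi.bdd_mul hφm.aestronglyMeasurable (Filter.Eventually.of_forall hφ1)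
  -- the derivative with the dilation on `g`
  have hJ : HasDerivAt (fun t => ∫ w, φ w * exp (-N w ^ p) * g (grushinDilation (1 + γ) t w))
      (∫ w, φ w * exp (-N w ^ p) * fderiv ℝ g w (grushinEuler (1 + γ) w)) 0 := by
    have := (hasDerivAt_integral_of_dominated_loc_of_deriv_le (μ := volume)
      (F := fun t w => φ w * exp (-N w ^ p) * g (grushinDilation (1 + γ) t w))
      (F' := fun t w => φ w * exp (-N w ^ p) * fderiv ℝ g (grushinDilation (1 + γ) t w)
        (grushinEuler (1 + γ) (grushinDilation (1 + γ) t w)))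
      (bound := fun w => ‖φ w * exp (-N w ^ p)‖ * B) (x₀ := (0 : ℝ)) (s := Set.univ)
      Filter.univ_mem ?_ ?_ ?_ ?_ ?_ ?_).2
    · simpa using this
    · refine Filter.Eventually.of_forall fun t => Measurable.aestronglyMeasurable ?_
      have := hgm.comp (hδ t)
      exact (hφm.mul hNpm.neg.exp).mul this
    · obtain ⟨M, hM⟩ := hgc.exists_bound_of_continuous hg.continuous
      simp only [grushinDilation_zero]
      exact hφN.mul_bdd hgm.aestronglyMeasurable (Filter.Eventually.of_forall hM)
    · simp only [grushinDilation_zero]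
      exact ((hφm.mul hNpm.neg.exp).mul hDc.measurable).aestronglyMeasurable
    · refine Filter.Eventually.of_forall fun w t _ => ?_
      rw [norm_mul]
      exact mul_le_mul_of_nonneg_left (hB _) (norm_nonneg _)
    · exact hφN.norm.mul_const B
    · refine Filter.Eventually.of_forall fun w t _ => HasDerivAt.const_mul _ ?_
      exact ((hg.differentiable one_ne_zero _).hasFDerivAt).comp_hasDerivAt t
        (hasDerivAt_grushinDilation _ t w)
  -- the derivative with the dilation on the weight
  have hNg : Integrable fun w => N w ^ p * g w :=
    (hNp.mul hg.continuous).integrable_of_hasCompactSupport hgc.mul_left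
  have hK : HasDerivAt (fun t => ∫ w, φ w * g w * exp (-(exp (-(p * t)) * N w ^ p)))
      (∫ w, φ w * exp (-N w ^ p) * (p * N w ^ p * g w)) 0 := by
    have := (hasDerivAt_integral_of_dominated_loc_of_deriv_le (μ := volume)
      (F := fun t w => φ w * g w * exp (-(exp (-(p * t)) * N w ^ p)))
      (F' := fun t w => φ w * g w *
        (exp (-(exp (-(p * t)) * N w ^ p)) * (p * exp (-(p * t)) * N w ^ p)))
      (bound := fun w => (p * exp p) * ‖N w ^ p * g w‖) (x₀ := (0 : ℝ)) (s := Set.Ioo (-1) 1)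
      (Ioo_mem_nhds (by norm_num) (by norm_num)) ?_ ?_ ?_ ?_ ?_ ?_).2
    · refine this.congr_deriv (integral_congr_ae (Filter.Eventually.of_forall fun w => ?_))
      simp only [mul_zero, neg_zero, exp_zero, one_mul, mul_one]
      ring
    · refine Filter.Eventually.of_forall fun t => Measurable.aestronglyMeasurable ?_
      exact (hφm.mul hgm).mul (hNpm.const_mul _).neg.exp
    · have h0 : Integrable fun w => g w * exp (-N w ^ p) :=
        (hg.continuous.mul hNp.neg.rexp).integrable_of_hasCompactSupport hgc.mul_right
      have := h0.bdd_mul hφm.aestronglyMeasurable (Filter.Eventually.of_forall hφ1)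
      simpa [mul_assoc] using this
    · exact ((hφm.mul hgm).mul ((hNpm.const_mul _).neg.exp.mul
        (hNpm.const_mul _))).aestronglyMeasurable
    · refine Filter.Eventually.of_forall fun w t ht => ?_
      have hn : 0 ≤ N w ^ p := rpow_nonneg (hN0 w) _
      have h1 : exp (-(exp (-(p * t)) * N w ^ p)) ≤ 1 :=
        exp_le_one_iff.2 (neg_nonpos.2 (mul_nonneg (exp_pos _).le hn))
      have h2 : exp (-(p * t)) ≤ exp p := exp_le_exp.2 (by nlinarith [ht.1])
      simp only [norm_mul, norm_eq_abs, abs_exp, abs_of_pos hp, abs_of_nonneg hn]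
      calc |φ w| * |g w| * (exp (-(exp (-(p * t)) * N w ^ p)) * (p * exp (-(p * t)) * N w ^ p))
          ≤ 1 * |g w| * (1 * (p * exp p * N w ^ p)) := by
            gcongr
            exact hφ1 w
        _ = p * exp p * (N w ^ p * |g w|) := by ring
    · exact hNg.norm.const_mul _
    · refine Filter.Eventually.of_forall fun w t _ => HasDerivAt.const_mul _ ?_
      refine (((((hasDerivAt_id t).const_mul p).neg).exp.mul_const (N w ^ p)).neg).exp.congr_deriv ?_
      simp only [id, Pi.neg_apply]
      ring
  have hJK : (fun t => ∫ w, φ w * exp (-N w ^ p) * g (grushinDilation (1 + γ) t w)) =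
      fun t => exp (-(Q * t)) * ∫ w, φ w * g w * exp (-(exp (-(p * t)) * N w ^ p)) := by
    funext t
    have hm : Measurable fun w => φ w * g w * exp (-(exp (-(p * t)) * N w ^ p)) :=
      (hφm.mul hgm).mul (hNpm.const_mul _).neg.exp
    rw [← integral_comp_grushinDilation (1 + γ) t hm]
    refine integral_congr_ae (Filter.Eventually.of_forall fun w => ?_)
    simp only [hφ, hN, GKaplan_dilation hγ]
    rw [mul_rpow (exp_pos t).le (GKaplan_nonneg _), ← exp_mul, ← mul_assoc, ← exp_add,
      show -(p * t) + t * p = 0 by ring, exp_zero, one_mul]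
    ring
  have hE : HasDerivAt (fun t : ℝ => exp (-(Q * t))) (-Q) 0 := by
    refine (((hasDerivAt_id (0 : ℝ)).const_mul Q).neg).exp.congr_deriv ?_
    simp
  have h := hE.mul hK
  rw [hJK] at hJ
  rw [hJ.unique h]
  simp only [mul_zero, neg_zero, exp_zero, one_mul]
  have : ∀ w, φ w * g w * exp (-N w ^ p) = φ w * exp (-N w ^ p) * g w := fun w => by ring
  simp only [this]
  ring

/-- The Cauchy–Schwarz bound of the dilation derivative by the Grushin subgradient. -/
lemma rpow_mul_abs_fderiv_grushinEuler_le (hγ : 0 ≤ γ)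
    (f : EuclideanSpace ℝ (Fin n) × EuclideanSpace ℝ (Fin m) → ℝ)
    (w : EuclideanSpace ℝ (Fin n) × EuclideanSpace ℝ (Fin m)) :
    ‖w.1‖ ^ γ * |fderiv ℝ f w (grushinEuler (1 + γ) w)| ≤
      √(gradSqG n m γ f w) * GKaplan n m γ w ^ (1 + γ) := by
  have hsplit : fderiv ℝ f w (grushinEuler (1 + γ) w) =
      ∑ i, w.1 i * dX n m f w i + (1 + γ) * ∑ j, w.2 j * dY n m f w j := by
    have h1 : w.1 = ∑ i, w.1 i • EuclideanSpace.single i (1 : ℝ) := by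
      ext i; simp [Finset.sum_apply, Pi.single_apply]
    have h2 : w.2 = ∑ i, w.2 i • EuclideanSpace.single i (1 : ℝ) := by
      ext i; simp [Finset.sum_apply, Pi.single_apply]
    have h3 : grushinEuler (1 + γ) w = ContinuousLinearMap.inl ℝ _ _ w.1 +
        (1 + γ) • ContinuousLinearMap.inr ℝ (EuclideanSpace ℝ (Fin n)) _ w.2 := by
      simp [grushinEuler]
    rw [h3]
    conv_lhs => rw [h1, h2]
    simp only [map_add, map_smul, map_sum, smul_eq_mul, ContinuousLinearMap.inl_apply,
      ContinuousLinearMap.inr_apply, dX, dY]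
  set A := ∑ i, dX n m f w i ^ 2
  set B := ∑ j, dY n m f w j ^ 2
  set r := ‖w.1‖ ^ γ with hr
  have hr0 : 0 ≤ r := by positivity
  have hr2 : ‖w.1‖ ^ (2 * γ) = r ^ 2 := by
    rw [hr, mul_comm, rpow_mul (norm_nonneg _), rpow_two]
  have hx : (∑ i, w.1 i * dX n m f w i) ^ 2 ≤ ‖w.1‖ ^ 2 * A := by
    rw [EuclideanSpace.real_norm_sq_eq]
    exact Finset.sum_mul_sq_le_sq_mul_sq _ _ _
  have hy : (∑ j, w.2 j * dY n m f w j) ^ 2 ≤ ‖w.2‖ ^ 2 * B := by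
    rw [EuclideanSpace.real_norm_sq_eq]
    exact Finset.sum_mul_sq_le_sq_mul_sq _ _ _
  have hA0 : 0 ≤ A := Finset.sum_nonneg fun _ _ => sq_nonneg _
  have hB0 : 0 ≤ B := Finset.sum_nonneg fun _ _ => sq_nonneg _
  set a := ∑ i, w.1 i * dX n m f w i
  set b := ∑ j, w.2 j * dY n m f w j
  have hN : (GKaplan n m γ w ^ (1 + γ)) ^ 2 = ‖w.1‖ ^ 2 * r ^ 2 + (1 + γ) ^ 2 * ‖w.2‖ ^ 2 := by
    rw [← rpow_two, ← rpow_mul (GKaplan_nonneg _), mul_comm, GKaplan_rpow hγ, ← hr2,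
      show (2 : ℝ) * (1 + γ) = 2 + 2 * γ by ring, rpow_add_of_nonneg (norm_nonneg _)
      (by norm_num) (by positivity), rpow_two]
  refine abs_le_of_sq_le_sq' ?_ (by have := GKaplan_nonneg (γ := γ) w; positivity) |>.2
  rw [mul_pow, sq_abs, mul_pow (√_), hN, sq_sqrt (by unfold gradSqG; positivity), hsplit]
  have hG : gradSqG n m γ f w = A + r ^ 2 * B := by rw [gradSqG, hr2]
  rw [hG]
  set X := ‖w.1‖
  set Y := (1 + γ) * ‖w.2‖ with hY
  set c := (1 + γ) * b with hc
  rw [show (1 + γ) ^ 2 * ‖w.2‖ ^ 2 = Y ^ 2 by rw [hY, mul_pow]]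
  have h1 : |a| ≤ X * √A := by
    refine abs_le_of_sq_le_sq ?_ (by positivity)
    rwa [mul_pow, sq_sqrt hA0]
  have h2 : |c| ≤ Y * √B := by
    refine abs_le_of_sq_le_sq ?_ (by positivity)
    rw [mul_pow Y, sq_sqrt hB0, hc, hY, mul_pow, mul_pow, mul_assoc]
    exact mul_le_mul_of_nonneg_left hy (sq_nonneg _)
  have h3 : |a + c| ≤ X * √A + Y * √B := (abs_add_le _ _).trans (add_le_add h1 h2)
  have h4 : (a + c) ^ 2 ≤ (X * √A + Y * √B) ^ 2 := by
    rw [← sq_abs]; gcongr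
  have hsA := sq_sqrt hA0
  have hsB := sq_sqrt hB0
  calc r ^ 2 * (a + c) ^ 2 ≤ r ^ 2 * (X * √A + Y * √B) ^ 2 := by gcongr
    _ ≤ (√A ^ 2 + r ^ 2 * √B ^ 2) * (X ^ 2 * r ^ 2 + Y ^ 2) := by
      nlinarith [sq_nonneg (√A * Y - r * √B * (X * r))]
    _ = _ := by rw [hsA, hsB]

lemma measurable_grushinWeight (hγ : 0 ≤ γ) (q : ℝ) :
    Measurable fun w : EuclideanSpace ℝ (Fin n) × EuclideanSpace ℝ (Fin m) =>
      ((‖w.1‖ / GKaplan n m γ w) ^ γ) ^ q :=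
  ((measurable_fst.norm.div (continuous_GKaplan hγ).measurable).pow_const _).pow_const _

lemma abs_grushinWeight_le_one (hγ : 0 ≤ γ) {q : ℝ} (hq : 0 ≤ q)
    (w : EuclideanSpace ℝ (Fin n) × EuclideanSpace ℝ (Fin m)) :
    |((‖w.1‖ / GKaplan n m γ w) ^ γ) ^ q| ≤ 1 := by
  have h0 : 0 ≤ ‖w.1‖ / GKaplan n m γ w := div_nonneg (norm_nonneg _) (GKaplan_nonneg w)
  have h1 : ‖w.1‖ / GKaplan n m γ w ≤ 1 :=
    div_le_one_of_le₀ (norm_fst_le_GKaplan hγ w) (GKaplan_nonneg w)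
  rw [abs_of_nonneg (by positivity)]
  exact rpow_le_one (by positivity) (rpow_le_one h0 h1 hγ) hq

lemma grushinWeight_dilation (hγ : 0 ≤ γ) (q t : ℝ)
    (w : EuclideanSpace ℝ (Fin n) × EuclideanSpace ℝ (Fin m)) :
    ((‖(grushinDilation (1 + γ) t w).1‖ / GKaplan n m γ (grushinDilation (1 + γ) t w)) ^ γ) ^ q =
      ((‖w.1‖ / GKaplan n m γ w) ^ γ) ^ q := by
  rw [GKaplan_dilation hγ]
  simp only [grushinDilation, norm_smul, norm_of_nonneg (exp_pos _).le]
  rw [mul_div_mul_left _ _ (exp_pos t).ne']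

lemma norm_rpow_mul_GKaplan_rpow (hγ : 0 ≤ γ) {p : ℝ} (hp : 0 < p) (q : ℝ)
    (w : EuclideanSpace ℝ (Fin n) × EuclideanSpace ℝ (Fin m)) :
    ‖w.1‖ ^ (γ * q) * GKaplan n m γ w ^ (p - γ * q) =
      ((‖w.1‖ / GKaplan n m γ w) ^ γ) ^ q * GKaplan n m γ w ^ p := by
  rcases (GKaplan_nonneg (γ := γ) w).eq_or_lt with h | h
  · have hw := eq_zero_of_GKaplan_eq_zero hγ h.symm
    rw [← h, zero_rpow hp.ne', mul_zero]
    rcases eq_or_ne (p - γ * q) 0 with h' | h'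
    · rw [hw, Prod.fst_zero, norm_zero, zero_rpow (by linarith), zero_mul]
    · rw [zero_rpow h', mul_zero]
  · rw [← rpow_mul (div_nonneg (norm_nonneg _) h.le), div_rpow (norm_nonneg _) h.le, rpow_sub h]
    ring

lemma rpow_div_mul_abs_fderiv_grushinEuler_le (hγ : 0 ≤ γ)
    (f : EuclideanSpace ℝ (Fin n) × EuclideanSpace ℝ (Fin m) → ℝ)
    (w : EuclideanSpace ℝ (Fin n) × EuclideanSpace ℝ (Fin m)) :
    (‖w.1‖ / GKaplan n m γ w) ^ γ * |fderiv ℝ f w (grushinEuler (1 + γ) w)| ≤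
      √(gradSqG n m γ f w) * GKaplan n m γ w := by
  rcases (GKaplan_nonneg (γ := γ) w).eq_or_lt with h | h
  · have hw := eq_zero_of_GKaplan_eq_zero hγ h.symm
    have hE : grushinEuler (1 + γ) w = 0 := by ext <;> simp [hw, grushinEuler]
    rw [hE, map_zero, abs_zero, mul_zero]
    exact mul_nonneg (sqrt_nonneg _) (GKaplan_nonneg _)
  · have := rpow_mul_abs_fderiv_grushinEuler_le hγ f w
    rw [div_rpow (norm_nonneg _) h.le, div_mul_eq_mul_div, div_le_iff₀ (by positivity), mul_assoc]
    rwa [rpow_add h, rpow_one] at this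

lemma continuous_gradSqG (hγ : 0 ≤ γ)
    {f : EuclideanSpace ℝ (Fin n) × EuclideanSpace ℝ (Fin m) → ℝ} (hf : ContDiff ℝ 1 f) :
    Continuous (gradSqG n m γ f) := by
  have h := hf.continuous_fderiv one_ne_zero
  unfold gradSqG dX dY
  refine (continuous_finsetSum _ fun i _ => (h.clm_apply continuous_const).pow 2).add
    ((continuous_fst.norm.rpow_const fun _ => Or.inr (by positivity)).mul
    (continuous_finsetSum _ fun i _ => (h.clm_apply continuous_const).pow 2))

lemma gradSqG_nonneg (f : EuclideanSpace ℝ (Fin n) × EuclideanSpace ℝ (Fin m) → ℝ)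
    (w : EuclideanSpace ℝ (Fin n) × EuclideanSpace ℝ (Fin m)) : 0 ≤ gradSqG n m γ f w := by
  unfold gradSqG; positivity

lemma HasCompactSupport.gradSqG
    {f : EuclideanSpace ℝ (Fin n) × EuclideanSpace ℝ (Fin m) → ℝ} (hf : HasCompactSupport f) :
    HasCompactSupport (gradSqG n m γ f) := by
  refine (hf.fderiv (𝕜 := ℝ)).mono fun w hw => ?_
  rw [Function.mem_support] at hw ⊢
  contrapose! hw
  simp [_root_.gradSqG, dX, dY, hw]

end Kaplan

/-- A weighted form of Young's inequality. -/
lemma rpow_mul_rpow_sub_one_mul_le {p q : ℝ} (hpq : q.HolderConjugate p) {u d s K F : ℝ}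
    (hu : 0 ≤ u) (hs : 0 ≤ s) (hK : 0 ≤ K) (hF : 0 ≤ F) (h : u * d ≤ s * K) :
    u ^ q * (q * F ^ (q - 1) * d) ≤ s ^ q + q / p * (u ^ q * K ^ p * F ^ q) := by
  have hq := hpq.lt
  have hq0 := hpq.pos
  have hexp : (q - 1) * p = q := by rw [sub_mul, one_mul, hpq.mul_eq_add]; ring
  have huq : u ^ q = u ^ (q - 1) * u := by
    conv_lhs => rw [← sub_add_cancel q 1, rpow_add_of_nonneg hu (by linarith) one_pos.le, rpow_one]
  have hY := young_inequality_of_nonneg hs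
    (by positivity : 0 ≤ u ^ (q - 1) * F ^ (q - 1) * K) hpq
  have hbp : (u ^ (q - 1) * F ^ (q - 1) * K) ^ p = u ^ q * K ^ p * F ^ q := by
    rw [mul_rpow (by positivity) hK, mul_rpow (by positivity) (by positivity), ← rpow_mul hu,
      ← rpow_mul hF, hexp]
    ring
  rw [hbp] at hY
  calc u ^ q * (q * F ^ (q - 1) * d) = q * (u ^ (q - 1) * F ^ (q - 1)) * (u * d) := by
        rw [huq]; ring
    _ ≤ q * (u ^ (q - 1) * F ^ (q - 1)) * (s * K) := by gcongr
    _ = q * (s * (u ^ (q - 1) * F ^ (q - 1) * K)) := by ring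
    _ ≤ q * (s ^ q / q + u ^ q * K ^ p * F ^ q / p) := by gcongr
    _ = _ := by field_simp

lemma fderiv_abs_rpow_apply {E : Type*} [NormedAddCommGroup E] [NormedSpace ℝ E] {f : E → ℝ}
    {q : ℝ} (hq : 1 < q) {w : E} (hf : DifferentiableAt ℝ f w) (v : E) :
    fderiv ℝ (fun z => |f z| ^ q) w v = q * |f w| ^ (q - 2) * f w * fderiv ℝ f w v := by
  have h : HasFDerivAt (fun z => |f z| ^ q) ((q * |f w| ^ (q - 2) * f w) • fderiv ℝ f w) w :=
    (hasDerivAt_abs_rpow (f w) hq).comp_hasFDerivAt w hf.hasFDerivAt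
  rw [h.fderiv, smul_apply, smul_eq_mul]

lemma abs_fderiv_abs_rpow_apply {E : Type*} [NormedAddCommGroup E] [NormedSpace ℝ E] {f : E → ℝ}
    {q : ℝ} (hq : 1 < q) {w : E} (hf : DifferentiableAt ℝ f w) (v : E) :
    |fderiv ℝ (fun z => |f z| ^ q) w v| = q * |f w| ^ (q - 1) * |fderiv ℝ f w v| := by
  rw [fderiv_abs_rpow_apply hq hf, abs_mul, abs_mul, abs_mul, abs_of_pos (by linarith),
    abs_of_nonneg (rpow_nonneg (abs_nonneg _) _)]
  rcases eq_or_ne (f w) 0 with h | h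
  · simp [h, zero_rpow (by linarith : q - 1 ≠ 0)]
  · rw [show q - 1 = q - 2 + 1 by ring, rpow_add_one (abs_ne_zero.2 h)]
    ring

/-- The inequality for the unnormalised weight `e^{-N^p}`. -/
lemma ubound_unnormalised {n m : ℕ} {γ p q : ℝ} (hn : 1 ≤ n) (hγ : 0 ≤ γ) (hp : 2 ≤ p)
    (hq : q = p / (p - 1))
    (hZi : Integrable (fun w => exp (-(GKaplan n m γ w) ^ p)))
    {f : EuclideanSpace ℝ (Fin n) × EuclideanSpace ℝ (Fin m) → ℝ}
    (hf : ContDiff ℝ 1 f) (hfc : HasCompactSupport f) :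
    ∫ w, exp (-(GKaplan n m γ w) ^ p) *
        (‖w.1‖ ^ (γ * q) * (GKaplan n m γ w) ^ (p - γ * q) * |f w| ^ q) ≤
      (n + (1 + γ) * m) *
        ((∫ w, exp (-(GKaplan n m γ w) ^ p) * (gradSqG n m γ f w) ^ (q / 2)) +
          ∫ w, exp (-(GKaplan n m γ w) ^ p) * |f w| ^ q) := by
  have hp0 : 0 < p := by linarith
  have hpq : q.HolderConjugate p := ((holderConjugate_iff_eq_conjExponent (by linarith)).2 hq).symm
  have hq1 : 1 < q := hpq.lt
  set N := GKaplan n m γ with hN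
  set Q : ℝ := n + (1 + γ) * m with hQ
  set φ : EuclideanSpace ℝ (Fin n) × EuclideanSpace ℝ (Fin m) → ℝ :=
    fun w => ((‖w.1‖ / N w) ^ γ) ^ q with hφ
  set g : EuclideanSpace ℝ (Fin n) × EuclideanSpace ℝ (Fin m) → ℝ := fun w => |f w| ^ q with hg
  have hφm : Measurable φ := measurable_grushinWeight hγ q
  have hφ1 : ∀ w, |φ w| ≤ 1 := abs_grushinWeight_le_one hγ hpq.nonneg
  have hφ0 : ∀ w, 0 ≤ φ w := fun w =>
    rpow_nonneg (rpow_nonneg (div_nonneg (norm_nonneg _) (GKaplan_nonneg w)) _) _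
  have hgs : ContDiff ℝ 1 g := (contDiff_norm_rpow hq1).comp hf
  have hgc : HasCompactSupport g :=
    hfc.comp_left (g := fun x : ℝ => |x| ^ q) (by simp [hpq.ne_zero])
  have hg0 : ∀ w, 0 ≤ g w := fun w => rpow_nonneg (abs_nonneg _) _
  have hNp : Continuous fun w => N w ^ p :=
    (continuous_GKaplan hγ).rpow_const fun _ => Or.inr hp0.le
  have hec : Continuous fun w => exp (-N w ^ p) := hNp.neg.rexp
  have hφI : ∀ {h : EuclideanSpace ℝ (Fin n) × EuclideanSpace ℝ (Fin m) → ℝ},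
      Integrable h → Integrable fun w => φ w * h w := fun hh =>
    hh.bdd_mul hφm.aestronglyMeasurable (Filter.Eventually.of_forall hφ1)
  have hibp := integral_fderiv_grushinEuler hγ hp0 hφm hφ1 (grushinWeight_dilation hγ q)
    hgs hgc hZi
  have hDc : Continuous fun w => fderiv ℝ g w (grushinEuler (1 + γ) w) :=
    (hgs.continuous_fderiv one_ne_zero).clm_apply (continuous_grushinEuler _)
  have hDs : HasCompactSupport fun w => fderiv ℝ g w (grushinEuler (1 + γ) w) := by
    refine (hgc.fderiv (𝕜 := ℝ)).mono fun w hw => ?_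
    rw [Function.mem_support] at hw ⊢
    contrapose! hw
    simp [hw]
  have hI1 : Integrable fun w => φ w * exp (-N w ^ p) * fderiv ℝ g w (grushinEuler (1 + γ) w) := by
    simp only [mul_assoc]
    exact hφI ((hec.mul hDc).integrable_of_hasCompactSupport hDs.mul_left)
  have hI2 : Integrable fun w => exp (-N w ^ p) * g w :=
    (hec.mul hgs.continuous).integrable_of_hasCompactSupport hgc.mul_left
  have hI3 : Integrable fun w => φ w * (exp (-N w ^ p) * (N w ^ p * g w)) :=
    hφI ((hec.mul (hNp.mul hgs.continuous)).integrable_of_hasCompactSupport hgc.mul_left.mul_left)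
  have hI4 : Integrable fun w => exp (-N w ^ p) * (gradSqG n m γ f w) ^ (q / 2) := by
    refine (hec.mul ((continuous_gradSqG hγ hf).rpow_const fun _ =>
      Or.inr (by linarith))).integrable_of_hasCompactSupport (HasCompactSupport.mul_left ?_)
    exact (hfc.gradSqG (γ := γ)).comp_left (g := fun x : ℝ => x ^ (q / 2))
      (zero_rpow (by linarith))
  set A := ∫ w, φ w * (exp (-N w ^ p) * (N w ^ p * g w)) with hA
  set S := ∫ w, exp (-N w ^ p) * (gradSqG n m γ f w) ^ (q / 2) with hS
  set I := ∫ w, exp (-N w ^ p) * g w with hI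
  have hA0 : 0 ≤ A := integral_nonneg fun w =>
    mul_nonneg (hφ0 w) (mul_nonneg (exp_pos _).le
      (mul_nonneg (rpow_nonneg (GKaplan_nonneg w) _) (hg0 w)))
  have hS0 : 0 ≤ S := integral_nonneg fun w =>
    mul_nonneg (exp_pos _).le (rpow_nonneg (gradSqG_nonneg f w) _)
  have hLHS : ∫ w, exp (-N w ^ p) * (‖w.1‖ ^ (γ * q) * N w ^ (p - γ * q) * |f w| ^ q) = A := by
    refine integral_congr_ae (Filter.Eventually.of_forall fun w => ?_)
    simp only [hN, norm_rpow_mul_GKaplan_rpow hγ hp0 q w, hφ, hg]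
    ring
  have hpA : ∫ w, φ w * exp (-N w ^ p) * (p * N w ^ p * g w) = p * A := by
    rw [hA, ← integral_const_mul]
    exact integral_congr_ae (Filter.Eventually.of_forall fun w => by ring)
  have hφg : ∫ w, φ w * exp (-N w ^ p) * g w ≤ I := by
    refine integral_mono (by simpa only [mul_assoc] using hφI hI2) hI2 fun w => ?_
    have h1 := (le_abs_self _).trans (hφ1 w)
    have h2 : 0 ≤ exp (-N w ^ p) * g w := mul_nonneg (exp_pos _).le (hg0 w)
    simp only [mul_assoc]
    exact mul_le_of_le_one_left h2 h1
  have hD : ∫ w, φ w * exp (-N w ^ p) * fderiv ℝ g w (grushinEuler (1 + γ) w) ≤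
      S + q / p * A := by
    rw [hA, hS, ← integral_const_mul, ← integral_add hI4 (hI3.const_mul _)]
    refine integral_mono hI1 (hI4.add (hI3.const_mul _)) fun w => ?_
    have hY := rpow_mul_rpow_sub_one_mul_le hpq
      (rpow_nonneg (div_nonneg (norm_nonneg w.1) (GKaplan_nonneg (γ := γ) w)) γ) (sqrt_nonneg _)
      (GKaplan_nonneg (γ := γ) w) (abs_nonneg (f w))
      (rpow_div_mul_abs_fderiv_grushinEuler_le hγ f w)
    rw [← abs_fderiv_abs_rpow_apply hq1 (hf.differentiable one_ne_zero w), sqrt_eq_rpow,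
      ← rpow_mul (gradSqG_nonneg f w), show 1 / 2 * q = q / 2 by ring] at hY
    have hle := (mul_le_mul_of_nonneg_left (le_abs_self (fderiv ℝ g w (grushinEuler (1 + γ) w)))
      (hφ0 w)).trans hY
    calc φ w * exp (-N w ^ p) * fderiv ℝ g w (grushinEuler (1 + γ) w)
        = exp (-N w ^ p) * (φ w * fderiv ℝ g w (grushinEuler (1 + γ) w)) := by ring
      _ ≤ exp (-N w ^ p) * _ := mul_le_mul_of_nonneg_left hle (exp_pos _).le
      _ = _ := by simp only [hφ, hg, hN]; ring
  rw [hpA] at hibp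
  rw [hLHS]
  have hQ1 : 1 ≤ Q := by
    have : (1 : ℝ) ≤ n := by exact_mod_cast hn
    have : 0 ≤ (1 + γ) * m := by positivity
    linarith
  have hqp : q / p ≤ 1 := by
    rw [hq, div_div, mul_comm, ← div_div, div_self hp0.ne']
    exact div_le_one_of_le₀ (by linarith) (by linarith)
  nlinarith [mul_le_mul_of_nonneg_left hφg (by linarith : 0 ≤ Q),
    mul_nonneg (by linarith : 0 ≤ p - q / p - 1) hA0, mul_nonneg (by linarith : 0 ≤ Q - 1) hS0]

lemma integral_muG {n m : ℕ} {γ p : ℝ} (hγ : 0 ≤ γ) (hp : 0 ≤ p)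
    (F : EuclideanSpace ℝ (Fin n) × EuclideanSpace ℝ (Fin m) → ℝ) :
    ∫ w, F w ∂(muG n m γ p) =
      (∫ v, exp (-(GKaplan n m γ v) ^ p))⁻¹ * ∫ w, exp (-(GKaplan n m γ w) ^ p) * F w := by
  have hNp : Continuous fun w => GKaplan n m γ w ^ p :=
    (continuous_GKaplan hγ).rpow_const fun _ => Or.inr hp
  have hZ : 0 ≤ ∫ v, exp (-(GKaplan n m γ v) ^ p) := integral_nonneg fun _ => (exp_pos _).le
  have hm : Measurable fun w => ENNReal.ofReal
      ((∫ v, exp (-(GKaplan n m γ v) ^ p))⁻¹ * exp (-(GKaplan n m γ w) ^ p)) :=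
    (hNp.neg.rexp.measurable.const_mul _).ennreal_ofReal
  rw [muG, integral_withDensity_eq_integral_toReal_smul hm
    (Filter.Eventually.of_forall fun _ => ENNReal.ofReal_lt_top), ← integral_const_mul]
  refine integral_congr_ae (Filter.Eventually.of_forall fun w => ?_)
  simp only [smul_eq_mul]
  rw [ENNReal.toReal_ofReal (mul_nonneg (inv_nonneg.2 hZ) (exp_pos _).le), mul_assoc]

end

/-- `U`-bound in `L^q` in the Grushin setting for `dμ = Z⁻¹ e^{-N^p} dξ`, `γ ≥ 0`,
`p ≥ 2`, `q = p/(p-1)`: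
`∫ |x|^{γq} N^{p-γq} |f|^q dμ ≤ C(∫ |∇_γ f|^q dμ + ∫ |f|^q dμ)`. -/
theorem ubound_Lq_grushin (n m : ℕ) (hn : 1 ≤ n) (hm : 1 ≤ m) (γ p q : ℝ)
    (hγ : 0 ≤ γ) (hp : 2 ≤ p) (hq : q = p / (p - 1)) :
    ∃ C > 0, ∀ f : EuclideanSpace ℝ (Fin n) × EuclideanSpace ℝ (Fin m) → ℝ,
      ContDiff ℝ (⊤ : ℕ∞) f → HasCompactSupport f →
      ∫ w, ‖w.1‖ ^ (γ * q) * (GKaplan n m γ w) ^ (p - γ * q) * |f w| ^ q ∂(muG n m γ p) ≤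
        C * ((∫ w, (gradSqG n m γ f w) ^ (q / 2) ∂(muG n m γ p)) +
             (∫ w, |f w| ^ q ∂(muG n m γ p))) := by
  have hnQ : (1 : ℝ) ≤ n := by exact_mod_cast hn
  refine ⟨n + (1 + γ) * m, by positivity, fun f hf hfc => ?_⟩
  have hp0 : 0 ≤ p := by linarith
  simp only [integral_muG hγ hp0]
  by_cases hZi : Integrable fun w => Real.exp (-(GKaplan n m γ w) ^ p)
  · rw [← mul_add, mul_left_comm]
    exact mul_le_mul_of_nonneg_left
      (ubound_unnormalised hn hγ hp hq hZi (hf.of_le (by exact_mod_cast le_top)) hfc)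
      (inv_nonneg.2 (integral_nonneg fun _ => (Real.exp_pos _).le))
  · simp [integral_undef hZi]
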